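/- Under the weight update of the AdaptiveFilter algorithm (experts algorithm with α-exp-concave losses and a new expert added each round with weight 1/(c+1)), for any two integers r < s ≤ T, the cumulative regret against the expert born at round r satisfies ∑_{c=r}^{s} [f_c(x̄_c) − f_c(x_c⁽ʳ⁾)] ≤ (4/α)·ln T. -/

import Mathlib

open Finset in
/-- Mixing the normalized multiplicative update of a positive probability vector with a new
coordinate of weight `1 / (c + 1)` keeps the weights positive and summing to one. -/
theorem weights_pos_and_sum_eq_one (p e : ℕ → ℕ → ℝ) (he : ∀ c i, 0 < e c i) (hp1 : p 1 1 = 1)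
    (hpnew : ∀ c, 1 ≤ c → p (c + 1) (c + 1) = 1 / ((c : ℝ) + 1))
    (hpmix : ∀ c, 1 ≤ c → ∀ i ∈ Icc 1 c,
      p (c + 1) i = (1 - 1 / ((c : ℝ) + 1)) *
        (p c i * e c i / ∑ j ∈ Icc 1 c, p c j * e c j))
    (c : ℕ) (hc : 1 ≤ c) :
    (∀ i ∈ Icc 1 c, 0 < p c i) ∧ ∑ i ∈ Icc 1 c, p c i = 1 := by
  induction c, hc using Nat.le_induction with
  | base => simp [hp1]
  | succ c hc ih =>
    obtain ⟨hpos, -⟩ := ih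
    have hc' : (0 : ℝ) < c := by exact_mod_cast hc
    have hmix : (0 : ℝ) < 1 - 1 / ((c : ℝ) + 1) := by
      rw [sub_pos, div_lt_one (by positivity)]
      linarith
    have hZ : 0 < ∑ j ∈ Icc 1 c, p c j * e c j :=
      sum_pos (fun j hj => mul_pos (hpos j hj) (he c j)) ⟨1, by simp [hc]⟩
    constructor
    · intro i hi
      rcases (mem_Icc.1 hi).2.eq_or_lt with rfl | hlt
      · rw [hpnew c hc]
        positivity
      · have hi' : i ∈ Icc 1 c := mem_Icc.2 ⟨(mem_Icc.1 hi).1, Nat.lt_succ_iff.1 hlt⟩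
        rw [hpmix c hc i hi']
        exact mul_pos hmix (div_pos (mul_pos (hpos i hi') (he c i)) hZ)
    · rw [sum_Icc_succ_top (by omega), hpnew c hc, sum_congr rfl (hpmix c hc), ← mul_sum,
        ← sum_div, div_self hZ.ne']
      ring


open Finset in
/-- Adaptive-regret bound for the experts scheme of the AdaptiveFilter algorithm:
with α-exp-concave losses and a new expert added each round with weight 1/(c+1),
the cumulative regret on any interval [r,s] against the expert born at round r is
at most (4/α)·ln T. -/
theorem adaptive_filter_interval_regret
    {d : ℕ} (K : Set (EuclideanSpace ℝ (Fin d))) (hK : Convex ℝ K)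
    (T r s : ℕ) (hr : 1 ≤ r) (hrs : r < s) (hsT : s ≤ T)
    (hT : Real.exp 1 ≤ (T : ℝ))
    (f : ℕ → EuclideanSpace ℝ (Fin d) → ℝ) (α : ℝ) (hα : 0 < α)
    (hconc : ∀ c, ConcaveOn ℝ K (fun x => Real.exp (-α * f c x)))
    (x : ℕ → ℕ → EuclideanSpace ℝ (Fin d))  -- x c j : prediction of expert j at round c
    (hx : ∀ c j, x c j ∈ K)
    (p phat : ℕ → ℕ → ℝ)
    (hp1 : p 1 1 = 1) (hp1' : ∀ j, j ≠ 1 → p 1 j = 0)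
    (hphat : ∀ c, 1 ≤ c → ∀ i,
      phat (c + 1) i = p c i * Real.exp (-α * f c (x c i)) /
        ∑ j ∈ Icc 1 c, p c j * Real.exp (-α * f c (x c j)))
    (hpnew : ∀ c, 1 ≤ c → p (c + 1) (c + 1) = 1 / ((c : ℝ) + 1))
    (hpmix : ∀ c, 1 ≤ c → ∀ i ∈ Icc 1 c,
      p (c + 1) i = (1 - 1 / ((c : ℝ) + 1)) * phat (c + 1) i)
    (xbar : ℕ → EuclideanSpace ℝ (Fin d))
    (hxbar : ∀ c, xbar c = ∑ j ∈ Icc 1 c, p c j • x c j) :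
    ∑ c ∈ Icc r s, (f c (xbar c) - f c (x c r)) ≤ (4 / α) * Real.log T := by
  set e : ℕ → ℕ → ℝ := fun c i => Real.exp (-α * f c (x c i))
  have he : ∀ c i, 0 < e c i := fun c i => Real.exp_pos _
  have hmix : ∀ c, 1 ≤ c → ∀ i ∈ Icc 1 c, p (c + 1) i = (1 - 1 / ((c : ℝ) + 1)) *
      (p c i * e c i / ∑ j ∈ Icc 1 c, p c j * e c j) := fun c hc i hi => by
    rw [hpmix c hc i hi, hphat c hc i]
  have hweights := weights_pos_and_sum_eq_one p e he hp1 hpnew hmix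
  have hZ : ∀ c, 1 ≤ c → 0 < ∑ j ∈ Icc 1 c, p c j * e c j := fun c hc =>
    sum_pos (fun j hj => mul_pos ((hweights c hc).1 j hj) (he c j)) ⟨1, by simp [hc]⟩
  have hscaled : ∀ c, r ≤ c → ((c + 1 : ℕ) : ℝ) * p (c + 1) r =
      c * (p c r * e c r / ∑ j ∈ Icc 1 c, p c j * e c j) := fun c hrc => by
    have hc : (0 : ℝ) < c := by exact_mod_cast hr.trans hrc
    rw [hmix c (hr.trans hrc) r (mem_Icc.2 ⟨hr, hrc⟩)]
    push_cast
    field_simp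
    ring
  have hstart : (r : ℝ) * p r r = 1 := by
    obtain ⟨m, rfl⟩ : ∃ m, r = m + 1 := ⟨r - 1, by omega⟩
    rcases Nat.eq_zero_or_pos m with rfl | hm
    · simp [hp1]
    · rw [hpnew m hm]
      push_cast
      field_simp
  have hstep : ∀ c, r ≤ c → α * (f c (xbar c) - f c (x c r)) ≤
      Real.log (((c + 1 : ℕ) : ℝ) * p (c + 1) r) - Real.log ((c : ℝ) * p c r) := by
    intro c hrc
    have hc1 := hr.trans hrc
    have hc : (0 : ℝ) < c := by exact_mod_cast hc1
    have hpr := (hweights c hc1).1 r (mem_Icc.2 ⟨hr, hrc⟩)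
    have hjensen : ∑ j ∈ Icc 1 c, p c j * e c j ≤ Real.exp (-α * f c (xbar c)) := by
      have := (hconc c).le_map_sum (fun j hj => ((hweights c hc1).1 j hj).le) (hweights c hc1).2
        (fun j _ => hx c j)
      simpa only [smul_eq_mul, ← hxbar c] using this
    have hlog := Real.log_le_log (hZ c hc1) hjensen
    rw [Real.log_exp] at hlog
    have hloge : Real.log (e c r) = -α * f c (x c r) := Real.log_exp _
    rw [hscaled c hrc, mul_div_assoc', ← mul_assoc,
      Real.log_div (mul_pos (mul_pos hc hpr) (he c r)).ne' (hZ c hc1).ne',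
      Real.log_mul (mul_pos hc hpr).ne' (he c r).ne', hloge]
    linarith
  have htelescope : ∀ n, r ≤ n → α * ∑ c ∈ Icc r n, (f c (xbar c) - f c (x c r)) ≤
      Real.log (((n + 1 : ℕ) : ℝ) * p (n + 1) r) := by
    intro n hn
    induction n, hn using Nat.le_induction with
    | base => simpa [hstart] using hstep r le_rfl
    | succ n hn ih =>
      rw [sum_Icc_succ_top (by omega), mul_add]
      linarith [hstep (n + 1) (by omega)]
  have hs1 : 1 ≤ s := hr.trans hrs.le
  have hs : (0 : ℝ) < s := by exact_mod_cast hs1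
  have hrmem : r ∈ Icc 1 s := mem_Icc.2 ⟨hr, hrs.le⟩
  have hnum := mul_pos ((hweights s hs1).1 r hrmem) (he s r)
  have hfrac : p s r * e s r / ∑ j ∈ Icc 1 s, p s j * e s j ≤ 1 :=
    (div_le_one (hZ s hs1)).2 <| single_le_sum (f := fun j => p s j * e s j)
      (fun j hj => (mul_pos ((hweights s hs1).1 j hj) (he s j)).le) hrmem
  have hsT' : (s : ℝ) ≤ T := by exact_mod_cast hsT
  have hbound : α * ∑ c ∈ Icc r s, (f c (xbar c) - f c (x c r)) ≤ Real.log T := by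
    refine (htelescope s hrs.le).trans ?_
    rw [hscaled s hrs.le]
    exact Real.log_le_log (mul_pos hs (div_pos hnum (hZ s hs1)))
      ((mul_le_of_le_one_right hs.le hfrac).trans hsT')
  have hlogT : 0 ≤ Real.log T := Real.log_natCast_nonneg T
  rw [div_mul_eq_mul_div, le_div_iff₀ hα]
  linarith
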